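/- arXiv:1404.2443 — 3 statements merged into one kernel-verified Lean document; each statement's English description precedes it below -/
import Mathlib

section
/- Every heptagon is a section of a polytope with at most 6 vertices in ℝ³. Precisely: if p_0, …, p_6 ∈ ℝ² are in clockwise convex position and P = conv{p_0, …, p_6}, then there exist a finite set V ⊆ ℝ³ with |V| ≤ 6 and an injective affine map f : ℝ² → ℝ³ such that conv(V) ∩ range(f) = f(P). -/
open Matrix

/-- Homogeneous coordinates of a point in the plane. -/
noncomputable def hat (p : Fin 2 → ℝ) : Fin 3 → ℝ := ![p 0, p 1, 1]

/-- Determinant of the 3×3 matrix with rows `u`, `v`, `w`. -/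
def det3 (u v w : Fin 3 → ℝ) : ℝ := Matrix.det (Matrix.of ![u, v, w])

lemma det3_eq (u v w : Fin 3 → ℝ) :
    det3 u v w = u 0 * (v 1 * w 2 - v 2 * w 1) - u 1 * (v 0 * w 2 - v 2 * w 0)
      + u 2 * (v 0 * w 1 - v 1 * w 0) := by
  simp [det3, Matrix.det_fin_three]
  ring

lemma det3_rotate (u v w : Fin 3 → ℝ) : det3 u v w = det3 v w u := by
  simp only [det3_eq]; ring

lemma det3_reverse (u v w : Fin 3 → ℝ) : det3 u v w = -det3 w v u := by
  simp only [det3_eq]; ring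

lemma det3_swap_right (u v w : Fin 3 → ℝ) : det3 u v w = -det3 u w v := by
  simp only [det3_eq]; ring

lemma det3_self_left (u v : Fin 3 → ℝ) : det3 u v u = 0 := by
  simp only [det3_eq]; ring

lemma det3_self_right (u v : Fin 3 → ℝ) : det3 u v v = 0 := by
  simp only [det3_eq]; ring

lemma det3_add_right (u v w z : Fin 3 → ℝ) : det3 u v (w + z) = det3 u v w + det3 u v z := by
  simp only [det3_eq, Pi.add_apply]; ring

lemma det3_sub_right (u v w z : Fin 3 → ℝ) : det3 u v (w - z) = det3 u v w - det3 u v z := by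
  simp only [det3_eq, Pi.sub_apply]; ring

lemma det3_smul_right (c : ℝ) (u v w : Fin 3 → ℝ) : det3 u v (c • w) = c * det3 u v w := by
  simp only [det3_eq, Pi.smul_apply, smul_eq_mul]; ring

lemma det3_zero_right (u v : Fin 3 → ℝ) : det3 u v 0 = 0 := by
  simp [det3_eq]

/-- The three-term Grassmann–Plücker relation. -/
lemma det3_plucker (o a b c d : Fin 3 → ℝ) :
    det3 o a c * det3 o b d = det3 o a b * det3 o c d + det3 o a d * det3 o b c := by
  simp only [det3_eq]; ring

/-- Cramer's rule, cleared of denominators. -/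
lemma det3_cramer (a b c q : Fin 3 → ℝ) :
    det3 a b c • q = det3 b c q • a + (-det3 a c q) • b + det3 a b q • c := by
  ext i
  fin_cases i <;> simp [det3_eq] <;> ring

/-- The inhomogeneous point of the plane with the given homogeneous coordinates. -/
noncomputable def dehat (z : Fin 3 → ℝ) : Fin 2 → ℝ := ![z 0 / z 2, z 1 / z 2]

lemma dehat_smul_hat {c : ℝ} (hc : c ≠ 0) (x : Fin 2 → ℝ) : dehat (c • hat x) = x := by
  ext i
  fin_cases i <;> simp [dehat, hat, hc]

lemma dehat_sum_mem {ι : Type*} [Fintype ι] {K : Set (Fin 2 → ℝ)} (hK : Convex ℝ K)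
    (c : ι → ℝ) (z : ι → Fin 3 → ℝ) (hc : ∀ i, 0 ≤ c i) (hz : ∀ i, 0 < z i 2)
    (hm : ∀ i, dehat (z i) ∈ K) (hpos : 0 < (∑ i, c i • z i) 2) :
    dehat (∑ i, c i • z i) ∈ K := by
  set s := (∑ i, c i • z i) 2 with hs
  have key : dehat (∑ i, c i • z i) = ∑ i, (c i * z i 2 / s) • dehat (z i) := by
    ext k
    have hz' : ∀ i, z i 2 ≠ 0 := fun i => (hz i).ne'
    fin_cases k <;>
      · simp only [dehat, ← hs, Finset.sum_apply, Pi.smul_apply, smul_eq_mul, Finset.sum_div]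
        simp only [Fin.zero_eta, Fin.mk_one, Matrix.cons_val_zero, Matrix.cons_val_one]
        refine Finset.sum_congr rfl fun i _ => ?_
        field_simp [hz' i]
  rw [key]
  refine hK.sum_mem (fun i _ => by have := hc i; have := hz i; positivity) ?_ (fun i _ => hm i)
  rw [← Finset.sum_div, div_eq_one_iff_eq hpos.ne', hs]
  simp

/-- The embedding of the plane as the horizontal coordinate plane of space. -/
noncomputable def horizontal : (Fin 2 → ℝ) →ᵃ[ℝ] (Fin 3 → ℝ) :=
  (Matrix.toLin' !![1, 0; 0, 1; 0, 0]).toAffineMap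

lemma horizontal_apply (x : Fin 2 → ℝ) : horizontal x = ![x 0, x 1, 0] := by
  ext i
  fin_cases i <;> simp [horizontal, Matrix.mulVec, dotProduct, Fin.sum_univ_two]

lemma horizontal_injective : Function.Injective horizontal := by
  intro x y h
  rw [horizontal_apply, horizontal_apply] at h
  ext i
  fin_cases i
  · simpa using congrFun h 0
  · simpa using congrFun h 1

/-- The point of space whose homogeneous coordinates are those of `z`, with height `h`. -/
noncomputable def liftAt (z : Fin 3 → ℝ) (h : ℝ) : Fin 3 → ℝ := ![z 0 / z 2, z 1 / z 2, h / z 2]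

/-- The points of a convex hull of lifts at opposite heights, in homogeneous coordinates. -/
lemma mem_convexHull_liftAt {u v : Fin 3 → Fin 3 → ℝ} (hu : ∀ i, 0 < u i 2) (hv : ∀ j, 0 < v j 2)
    {y : Fin 3 → ℝ}
    (hy : y ∈ convexHull ℝ
      (Set.range (fun i => liftAt (u i) 1) ∪ Set.range (fun j => liftAt (v j) (-1)))) :
    ∃ a b : Fin 3 → ℝ, (∀ i, 0 ≤ a i) ∧ (∀ j, 0 ≤ b j) ∧
      ∑ i, a i • u i + ∑ j, b j • v j = ![y 0, y 1, 1] ∧ y 2 = ∑ i, a i - ∑ j, b j := by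
  revert y
  change convexHull ℝ _ ⊆ {y | _}
  refine convexHull_min ?_ ?_
  · rintro _ (⟨i, rfl⟩ | ⟨j, rfl⟩)
    · refine ⟨Pi.single i (1 / u i 2), 0, fun k => ?_, fun _ => le_rfl, ?_, ?_⟩
      · have := hu i
        by_cases h : k = i
        · subst h; simp [this.le]
        · simp [h]
      · have := (hu i).ne'
        have h : ∑ k, (Pi.single i (1 / u i 2) : Fin 3 → ℝ) k • u k = (1 / u i 2) • u i := by
          rw [Finset.sum_eq_single i] <;> simp +contextual
        rw [h]
        ext k
        fin_cases k <;> simp [liftAt, this] <;> field_simp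
      · simp [liftAt]
    · refine ⟨0, Pi.single j (1 / v j 2), fun _ => le_rfl, fun k => ?_, ?_, ?_⟩
      · have := hv j
        by_cases h : k = j
        · subst h; simp [this.le]
        · simp [h]
      · have := (hv j).ne'
        have h : ∑ k, (Pi.single j (1 / v j 2) : Fin 3 → ℝ) k • v k = (1 / v j 2) • v j := by
          rw [Finset.sum_eq_single j] <;> simp +contextual
        rw [h]
        ext k
        fin_cases k <;> simp [liftAt, this] <;> field_simp
      · simp [liftAt]; ring
  · rintro y ⟨a, b, ha, hb, h1, h2⟩ y' ⟨a', b', ha', hb', h1', h2'⟩ s t hs ht hst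
    refine ⟨s • a + t • a', s • b + t • b', fun i => ?_, fun j => ?_, ?_, ?_⟩
    · have := ha i; have := ha' i
      simp only [Pi.add_apply, Pi.smul_apply, smul_eq_mul]; positivity
    · have := hb j; have := hb' j
      simp only [Pi.add_apply, Pi.smul_apply, smul_eq_mul]; positivity
    · have e : ![(s • y + t • y') 0, (s • y + t • y') 1, 1]
          = s • ![y 0, y 1, 1] + t • ![y' 0, y' 1, 1] := by
        ext k; fin_cases k <;> simp [hst]
      rw [e, ← h1, ← h1']
      simp only [Pi.add_apply, Pi.smul_apply, smul_eq_mul, add_smul, mul_smul,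
        Finset.sum_add_distrib, Finset.smul_sum, smul_add]
      abel
    · simp only [Pi.add_apply, Pi.smul_apply, smul_eq_mul, h2, h2', Finset.sum_add_distrib,
        ← Finset.mul_sum]
      ring

/-- A point set is the horizontal section of a polytope with six vertices as soon as its cone is
spanned by the pairwise sums of two triples of vectors of positive weight. -/
lemma exists_section_of_pos {n : ℕ} (p : Fin n → Fin 2 → ℝ) (u v : Fin 3 → Fin 3 → ℝ)
    (hu : ∀ i, 0 < u i 2) (hv : ∀ j, 0 < v j 2)
    (hm : ∀ i j, dehat (u i + v j) ∈ convexHull ℝ (Set.range p))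
    (hp : ∀ k, ∃ i j, dehat (u i + v j) = p k) :
    ∃ (V : Finset (Fin 3 → ℝ)) (f : (Fin 2 → ℝ) →ᵃ[ℝ] (Fin 3 → ℝ)),
      V.card ≤ 6 ∧ Function.Injective f ∧
      convexHull ℝ (V : Set (Fin 3 → ℝ)) ∩ Set.range f =
        f '' (convexHull ℝ (Set.range p)) := by
  classical
  refine ⟨Finset.univ.image (fun i => liftAt (u i) 1) ∪
    Finset.univ.image (fun j => liftAt (v j) (-1)),
    horizontal, ?_, horizontal_injective, ?_⟩
  · refine (Finset.card_union_le _ _).trans ?_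
    have h1 := Finset.card_image_le (s := Finset.univ) (f := fun i => liftAt (u i) 1)
    have h2 := Finset.card_image_le (s := Finset.univ) (f := fun j => liftAt (v j) (-1))
    simp only [Finset.card_univ, Fintype.card_fin] at h1 h2
    omega
  rw [Finset.coe_union, Finset.coe_image, Finset.coe_image, Finset.coe_univ, Set.image_univ,
    Set.image_univ]
  refine Set.Subset.antisymm ?_ ?_
  · rintro _ ⟨hy, x, rfl⟩
    refine ⟨x, ?_, rfl⟩
    obtain ⟨a, b, ha, hb, h1, h2⟩ := mem_convexHull_liftAt hu hv hy
    rw [horizontal_apply] at h1 h2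
    set s := ∑ i, a i with hs
    have hsb : ∑ j, b j = s := by
      have : (0 : ℝ) = s - ∑ j, b j := by simpa using h2
      linarith
    have hx : ∑ i, a i • u i + ∑ j, b j • v j = hat x := by
      rw [h1]; simp [hat]
    have hs0 : 0 ≤ s := Finset.sum_nonneg fun i _ => ha i
    have hspos : 0 < s := by
      refine lt_of_le_of_ne hs0 fun h => ?_
      have ea : ∀ i, a i = 0 := fun i =>
        (Finset.sum_eq_zero_iff_of_nonneg fun i _ => ha i).1 h.symm i (Finset.mem_univ i)
      have eb : ∀ i, b i = 0 := fun i =>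
        (Finset.sum_eq_zero_iff_of_nonneg fun i _ => hb i).1 (hsb.trans h.symm) i
          (Finset.mem_univ i)
      have := congrFun hx 2
      simp [ea, eb, hat] at this
    have key : ∑ ij : Fin 3 × Fin 3, (a ij.1 * b ij.2) • (u ij.1 + v ij.2) = s • hat x := by
      rw [← hx, Fintype.sum_prod_type]
      simp only [smul_add, Finset.sum_add_distrib, mul_smul]
      congr 1
      · rw [Finset.smul_sum]
        refine Finset.sum_congr rfl fun i _ => ?_
        simp only [← Finset.smul_sum, ← Finset.sum_smul, hsb]
        exact smul_comm _ _ _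
      · simp only [← Finset.smul_sum, ← Finset.sum_smul, ← hs]
    rw [← dehat_smul_hat hspos.ne' x, ← key]
    refine dehat_sum_mem (convex_convexHull ℝ _) _ _ (fun ij => mul_nonneg (ha _) (hb _))
      (fun ij => add_pos (hu _) (hv _)) (fun ij => hm _ _) ?_
    rw [key]
    simpa [hat] using hspos
  · rw [AffineMap.image_convexHull]
    refine Set.subset_inter (convexHull_min ?_ (convex_convexHull ℝ _)) ?_
    · rintro _ ⟨_, ⟨k, rfl⟩, rfl⟩
      obtain ⟨i, j, h⟩ := hp k
      rw [← h]
      have hui := hu i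
      have hvj := hv j
      have e : horizontal (dehat (u i + v j)) = (u i 2 / (u i 2 + v j 2)) • liftAt (u i) 1
          + (v j 2 / (u i 2 + v j 2)) • liftAt (v j) (-1) := by
        rw [horizontal_apply]
        ext k
        fin_cases k <;> simp [dehat, liftAt] <;> field_simp
        ring
      rw [e]
      have hK := convex_convexHull ℝ
        (Set.range (fun i => liftAt (u i) 1) ∪ Set.range (fun j => liftAt (v j) (-1)))
      refine hK (subset_convexHull ℝ _ (Or.inl ⟨i, rfl⟩))
        (subset_convexHull ℝ _ (Or.inr ⟨j, rfl⟩)) (by positivity) (by positivity) ?_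
      field_simp
    · rw [← AffineMap.image_convexHull]
      exact Set.image_subset_range _ _

lemma exists_section {n : ℕ} (p : Fin n → Fin 2 → ℝ) (u v : Fin 3 → Fin 3 → ℝ)
    (hpos : ∀ i j, 0 < (u i + v j) 2)
    (hm : ∀ i j, dehat (u i + v j) ∈ convexHull ℝ (Set.range p))
    (hp : ∀ k, ∃ i j, dehat (u i + v j) = p k) :
    ∃ (V : Finset (Fin 3 → ℝ)) (f : (Fin 2 → ℝ) →ᵃ[ℝ] (Fin 3 → ℝ)),
      V.card ≤ 6 ∧ Function.Injective f ∧
      convexHull ℝ (V : Set (Fin 3 → ℝ)) ∩ Set.range f =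
        f '' (convexHull ℝ (Set.range p)) := by
  obtain ⟨i₀, hi₀⟩ := Finite.exists_min fun i => u i 2
  obtain ⟨j₀, hj₀⟩ := Finite.exists_min fun j => v j 2
  have h₀ := hpos i₀ j₀
  simp only [Pi.add_apply] at h₀
  let w : Fin 3 → ℝ := ![0, 0, (v j₀ 2 - u i₀ 2) / 2]
  have e : ∀ i j, (u i + w) + (v j - w) = u i + v j := fun i j => by abel
  refine exists_section_of_pos p (fun i => u i + w) (fun j => v j - w) (fun i => ?_) (fun j => ?_)
    (fun i j => by simpa only [e] using hm i j) (fun k => by simpa only [e] using hp k)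
  · have := hi₀ i
    simp only [Pi.add_apply, w, Matrix.cons_val]
    linarith
  · have := hj₀ j
    simp only [Pi.sub_apply, w, Matrix.cons_val]
    linarith

lemma dehat_mem_of_cone_triangle {K : Set (Fin 2 → ℝ)} (hK : Convex ℝ K) {a b c : Fin 2 → ℝ}
    (ha : a ∈ K) (hb : b ∈ K) (hc : c ∈ K) {q : Fin 3 → ℝ} (hq : q ≠ 0)
    (habc : 0 < det3 (hat a) (hat b) (hat c)) (hbc : 0 ≤ det3 (hat b) (hat c) q)
    (hac : det3 (hat a) (hat c) q ≤ 0) (hab : 0 ≤ det3 (hat a) (hat b) q) :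
    0 < q 2 ∧ dehat q ∈ K := by
  have hcr := det3_cramer (hat a) (hat b) (hat c) q
  set D := det3 (hat a) (hat b) (hat c)
  set x := det3 (hat b) (hat c) q
  set y := det3 (hat a) (hat c) q
  set z := det3 (hat a) (hat b) q
  have hq' : q = ∑ i : Fin 3, (![x / D, -y / D, z / D] : Fin 3 → ℝ) i •
      (![hat a, hat b, hat c] : Fin 3 → Fin 3 → ℝ) i := by
    have : q = D⁻¹ • D • q := by rw [smul_smul, inv_mul_cancel₀ habc.ne', one_smul]
    rw [this, hcr]
    simp only [Fin.sum_univ_three, Matrix.cons_val, smul_add, smul_smul]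
    ring_nf
  have h2 : q 2 = (x + -y + z) / D := by
    rw [hq']
    simp [Fin.sum_univ_three, hat]
    ring
  have hsum : 0 < x + -y + z := by
    refine lt_of_le_of_ne (by linarith) fun h => hq ?_
    have hx : x = 0 := by linarith
    have hy : y = 0 := by linarith
    have hz : z = 0 := by linarith
    rw [hq']
    simp [Fin.sum_univ_three, hx, hy, hz]
  have hpos : 0 < q 2 := by rw [h2]; positivity
  refine ⟨hpos, ?_⟩
  have e : ∀ t : Fin 2 → ℝ, dehat (hat t) = t := fun t => by
    simpa using dehat_smul_hat one_ne_zero t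
  rw [hq'] at hpos ⊢
  refine dehat_sum_mem hK _ _ (fun i => ?_) (fun i => ?_) (fun i => ?_) hpos
  · fin_cases i
    · exact div_nonneg hbc habc.le
    · exact div_nonneg (neg_nonneg.2 hac) habc.le
    · exact div_nonneg hab habc.le
  · fin_cases i <;> simp [hat]
  · fin_cases i <;> simpa [e]

/-- A vector in the angle at `a` between the rays to `b` and `e` that is on the inner side of the
edges `bc`, `cd`, `de` belongs to the cone over the convex pentagon `abcde`. -/
lemma dehat_mem_of_cone_pentagon {K : Set (Fin 2 → ℝ)} (hK : Convex ℝ K) {a b c d e : Fin 2 → ℝ}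
    (ha : a ∈ K) (hb : b ∈ K) (hc : c ∈ K) (hd : d ∈ K) (he : e ∈ K)
    (habc : 0 < det3 (hat a) (hat b) (hat c)) (hacd : 0 < det3 (hat a) (hat c) (hat d))
    (hade : 0 < det3 (hat a) (hat d) (hat e)) {q : Fin 3 → ℝ}
    (hab : 0 < det3 (hat a) (hat b) q) (hbc : 0 ≤ det3 (hat b) (hat c) q)
    (hcd : 0 ≤ det3 (hat c) (hat d) q) (hde : 0 ≤ det3 (hat d) (hat e) q)
    (hae : det3 (hat a) (hat e) q ≤ 0) :
    0 < q 2 ∧ dehat q ∈ K := by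
  have hq : q ≠ 0 := by
    rintro rfl
    simp [det3_zero_right] at hab
  rcases le_total (det3 (hat a) (hat c) q) 0 with h1 | h1
  · exact dehat_mem_of_cone_triangle hK ha hb hc hq habc hbc h1 hab.le
  rcases le_total (det3 (hat a) (hat d) q) 0 with h2 | h2
  · exact dehat_mem_of_cone_triangle hK ha hc hd hq hacd hcd h2 h1
  · exact dehat_mem_of_cone_triangle hK ha hd he hq hade hde hae h2

/-- Points in counterclockwise convex position. -/
def Ccw (p : Fin 7 → Fin 2 → ℝ) : Prop :=
  ∀ i j k : Fin 7, i < j → j < k → 0 < det3 (hat (p i)) (hat (p j)) (hat (p k))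

/-- The line `p₀p₄` leaves `p₀` on the correct side of the intersection of `p₁p₂` and `p₅p₆`. -/
def LeftGood (p : Fin 7 → Fin 2 → ℝ) : Prop :=
  det3 (hat (p 0)) (hat (p 1)) (hat (p 2)) * det3 (hat (p 4)) (hat (p 5)) (hat (p 6)) ≤
    det3 (hat (p 0)) (hat (p 5)) (hat (p 6)) * det3 (hat (p 1)) (hat (p 2)) (hat (p 4))

/-- The line `p₀p₃` leaves `p₀` on the correct side of the intersection of `p₁p₂` and `p₅p₆`. -/
def RightGood (p : Fin 7 → Fin 2 → ℝ) : Prop :=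
  det3 (hat (p 0)) (hat (p 5)) (hat (p 6)) * det3 (hat (p 1)) (hat (p 2)) (hat (p 3)) ≤
    det3 (hat (p 0)) (hat (p 1)) (hat (p 2)) * det3 (hat (p 3)) (hat (p 5)) (hat (p 6))

/-- The cyclic relabelling of a heptagon. -/
def relabel (p : Fin 7 → Fin 2 → ℝ) (r : Fin 7) : Fin 7 → Fin 2 → ℝ := fun i => p (i + r)

lemma relabel_zero (p : Fin 7 → Fin 2 → ℝ) : relabel p 0 = p := by
  funext i
  simp [relabel]

lemma relabel_relabel (p : Fin 7 → Fin 2 → ℝ) (r s : Fin 7) :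
    relabel (relabel p r) s = relabel p (r + s) := by
  funext i
  simp only [relabel]
  rw [add_assoc, add_comm s]

lemma range_relabel (p : Fin 7 → Fin 2 → ℝ) (r : Fin 7) : Set.range (relabel p r) = Set.range p :=
  (Equiv.addRight r).surjective.range_comp p

lemma Ccw.ccw_relabel_one {p : Fin 7 → Fin 2 → ℝ} (hp : Ccw p) : Ccw (relabel p 1) := by
  intro i j k hij hjk
  simp only [relabel]
  by_cases hk : k = 6
  · subst hk
    rw [← det3_rotate]
    exact hp _ _ _ (by revert i; revert j; decide) (by revert i; revert j; decide)
  · exact hp _ _ _ (by omega) (by omega)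

open Fin.CommRing in
lemma Ccw.ccw_relabel {p : Fin 7 → Fin 2 → ℝ} (hp : Ccw p) (r : Fin 7) : Ccw (relabel p r) := by
  have h : ∀ n : ℕ, Ccw (relabel p (n : Fin 7)) := by
    intro n
    induction n with
    | zero => simpa [relabel_zero] using hp
    | succ n ih =>
      have := ih.ccw_relabel_one
      rwa [relabel_relabel, ← Nat.cast_succ] at this
  simpa using h r

lemma exists_section_of_good {p : Fin 7 → Fin 2 → ℝ} (hp : Ccw p) (hl : LeftGood p)
    (hr : RightGood p) :
    ∃ (V : Finset (Fin 3 → ℝ)) (f : (Fin 2 → ℝ) →ᵃ[ℝ] (Fin 3 → ℝ)),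
      V.card ≤ 6 ∧ Function.Injective f ∧
      convexHull ℝ (V : Set (Fin 3 → ℝ)) ∩ Set.range f =
        f '' (convexHull ℝ (Set.range p)) := by
  unfold LeftGood at hl
  unfold RightGood at hr
  have pos : ∀ i j k : Fin 7, i < j ∧ j < k → 0 < det3 (hat (p i)) (hat (p j)) (hat (p k)) :=
    fun i j k h => hp i j k h.1 h.2
  have h012 := pos 0 1 2 (by decide)
  have h013 := pos 0 1 3 (by decide)
  have h014 := pos 0 1 4 (by decide)
  have h023 := pos 0 2 3 (by decide)
  have h034 := pos 0 3 4 (by decide)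
  have h036 := pos 0 3 6 (by decide)
  have h045 := pos 0 4 5 (by decide)
  have h046 := pos 0 4 6 (by decide)
  have h056 := pos 0 5 6 (by decide)
  have h123 := pos 1 2 3 (by decide)
  have h234 := pos 2 3 4 (by decide)
  have h345 := pos 3 4 5 (by decide)
  have h456 := pos 4 5 6 (by decide)
  have hK := convex_convexHull ℝ (Set.range p)
  have mem : ∀ k, p k ∈ convexHull ℝ (Set.range p) := fun k => subset_convexHull ℝ _ ⟨k, rfl⟩
  -- the affine dependencies of the quadrilaterals `p₀p₁p₂p₃` and `p₀p₄p₅p₆`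
  obtain ⟨a₁, a₂, a₃, ha₁, ha₂, ha₃, ha, ea₃⟩ : ∃ a₁ a₂ a₃ : ℝ, 0 < a₁ ∧ 0 < a₂ ∧ 0 < a₃ ∧
      a₁ • hat (p 1) - hat (p 0) = a₂ • hat (p 2) - a₃ • hat (p 3) ∧
      a₃ = det3 (hat (p 0)) (hat (p 1)) (hat (p 2)) / det3 (hat (p 1)) (hat (p 2)) (hat (p 3)) := by
    refine ⟨_, _, _, div_pos h023 h123, div_pos h013 h123, div_pos h012 h123, ?_, rfl⟩
    have := det3_cramer (hat (p 1)) (hat (p 2)) (hat (p 3)) (hat (p 0))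
    ext i
    have hi := congrFun this i
    simp only [Pi.add_apply, Pi.sub_apply, Pi.smul_apply, smul_eq_mul] at hi ⊢
    rw [← det3_rotate (hat (p 0)), ← det3_rotate (hat (p 0)), ← det3_rotate (hat (p 0))] at hi
    field_simp
    linarith
  obtain ⟨b₄, b₅, b₆, hb₄, hb₅, hb₆, hb, eb₄⟩ : ∃ b₄ b₅ b₆ : ℝ, 0 < b₄ ∧ 0 < b₅ ∧ 0 < b₆ ∧
      b₄ • hat (p 4) - hat (p 0) = b₅ • hat (p 5) - b₆ • hat (p 6) ∧
      b₄ = det3 (hat (p 0)) (hat (p 5)) (hat (p 6)) / det3 (hat (p 4)) (hat (p 5)) (hat (p 6)) := by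
    refine ⟨_, _, _, div_pos h056 h456, div_pos h046 h456, div_pos h045 h456, ?_, rfl⟩
    have := det3_cramer (hat (p 4)) (hat (p 5)) (hat (p 6)) (hat (p 0))
    ext i
    have hi := congrFun this i
    simp only [Pi.add_apply, Pi.sub_apply, Pi.smul_apply, smul_eq_mul] at hi ⊢
    rw [← det3_rotate (hat (p 0)), ← det3_rotate (hat (p 0)), ← det3_rotate (hat (p 0))] at hi
    field_simp
    linarith
  have hq : 0 < (a₁ • hat (p 1) - hat (p 0) + b₄ • hat (p 4)) 2 ∧
      dehat (a₁ • hat (p 1) - hat (p 0) + b₄ • hat (p 4)) ∈ convexHull ℝ (Set.range p) := by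
    refine dehat_mem_of_cone_pentagon hK (mem 0) (mem 1) (mem 2) (mem 3) (mem 4)
      h012 h023 h034 ?_ ?_ ?_ ?_ ?_
    · simp only [det3_add_right, det3_sub_right, det3_smul_right, det3_self_left, det3_self_right]
      nlinarith
    · simp only [det3_add_right, det3_sub_right, det3_smul_right, det3_self_left]
      rw [← det3_rotate (hat (p 0)), eb₄, div_mul_eq_mul_div, mul_zero, zero_sub, neg_add_eq_sub,
        sub_nonneg, le_div_iff₀ h456]
      exact hl
    · rw [ha]
      simp only [det3_add_right, det3_sub_right, det3_smul_right, det3_self_left, det3_self_right]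
      nlinarith
    · rw [ha]
      simp only [det3_add_right, det3_sub_right, det3_smul_right, det3_self_left, det3_self_right]
      rw [← det3_rotate (hat (p 2))]
      nlinarith
    · simp only [det3_add_right, det3_sub_right, det3_smul_right, det3_self_left, det3_self_right]
      rw [det3_swap_right]
      nlinarith
  have hq' : 0 < (b₆ • hat (p 6) - hat (p 0) + a₃ • hat (p 3)) 2 ∧
      dehat (b₆ • hat (p 6) - hat (p 0) + a₃ • hat (p 3)) ∈ convexHull ℝ (Set.range p) := by
    have e : b₆ • hat (p 6) - hat (p 0) = b₅ • hat (p 5) - b₄ • hat (p 4) := by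
      linear_combination hb
    refine dehat_mem_of_cone_pentagon hK (mem 0) (mem 3) (mem 4) (mem 5) (mem 6)
      h034 h045 h056 ?_ ?_ ?_ ?_ ?_
    · simp only [det3_add_right, det3_sub_right, det3_smul_right, det3_self_left, det3_self_right]
      nlinarith
    · rw [e]
      simp only [det3_add_right, det3_sub_right, det3_smul_right, det3_self_left, det3_self_right]
      nlinarith
    · rw [e]
      simp only [det3_add_right, det3_sub_right, det3_smul_right, det3_self_left, det3_self_right]
      rw [← det3_rotate (hat (p 3))]
      nlinarith
    · simp only [det3_add_right, det3_sub_right, det3_smul_right, det3_self_right]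
      rw [← det3_rotate (hat (p 0)), ← det3_rotate (hat (p 3)), ea₃, div_mul_eq_mul_div, mul_zero,
        zero_sub, neg_add_eq_sub, sub_nonneg, le_div_iff₀ h123]
      exact hr
    · simp only [det3_add_right, det3_sub_right, det3_smul_right, det3_self_left, det3_self_right]
      rw [det3_swap_right]
      nlinarith
  let u : Fin 3 → Fin 3 → ℝ := ![a₁ • hat (p 1) - hat (p 0), 0, b₆ • hat (p 6) - hat (p 0)]
  let v : Fin 3 → Fin 3 → ℝ := ![a₃ • hat (p 3), hat (p 0), b₄ • hat (p 4)]
  have e00 : u 0 + v 0 = a₂ • hat (p 2) := by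
    change a₁ • hat (p 1) - hat (p 0) + a₃ • hat (p 3) = _
    rw [ha]; abel
  have e01 : u 0 + v 1 = a₁ • hat (p 1) := sub_add_cancel _ _
  have e10 : u 1 + v 0 = a₃ • hat (p 3) := zero_add _
  have e11 : u 1 + v 1 = (1 : ℝ) • hat (p 0) := (zero_add _).trans (one_smul _ _).symm
  have e12 : u 1 + v 2 = b₄ • hat (p 4) := zero_add _
  have e21 : u 2 + v 1 = b₆ • hat (p 6) := sub_add_cancel _ _
  have e22 : u 2 + v 2 = b₅ • hat (p 5) := by
    change b₆ • hat (p 6) - hat (p 0) + b₄ • hat (p 4) = _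
    rw [sub_add_eq_add_sub, add_sub_assoc, hb]; abel
  have vertex : ∀ {i j : Fin 3} {c : ℝ} {k : Fin 7}, 0 < c → u i + v j = c • hat (p k) →
      0 < (u i + v j) 2 ∧ dehat (u i + v j) ∈ convexHull ℝ (Set.range p) := by
    intro i j c k hc h
    rw [h, dehat_smul_hat hc.ne']
    exact ⟨by simpa [hat] using hc, mem k⟩
  have all : ∀ i j, 0 < (u i + v j) 2 ∧ dehat (u i + v j) ∈ convexHull ℝ (Set.range p) := by
    intro i j
    fin_cases i <;> fin_cases j
    exacts [vertex ha₂ e00, vertex ha₁ e01, hq, vertex ha₃ e10, vertex one_pos e11,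
      vertex hb₄ e12, hq', vertex hb₆ e21, vertex hb₅ e22]
  refine exists_section p u v (fun i j => (all i j).1) (fun i j => (all i j).2) fun k => ?_
  have cover : ∀ {i j : Fin 3} {c : ℝ} {k : Fin 7}, 0 < c → u i + v j = c • hat (p k) →
      ∃ i j, dehat (u i + v j) = p k := fun {i j c k} hc h =>
    ⟨i, j, by rw [h, dehat_smul_hat hc.ne']⟩
  fin_cases k
  exacts [cover one_pos e11, cover ha₁ e01, cover ha₂ e00, cover ha₃ e10, cover hb₄ e12,
    cover hb₅ e22, cover hb₆ e21]

lemma Ccw.leftGood_relabel_three {p : Fin 7 → Fin 2 → ℝ} (hp : Ccw p) (h : ¬ RightGood p) :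
    LeftGood (relabel p 3) := by
  by_contra h'
  unfold RightGood at h
  change ¬ (det3 (hat (p 3)) (hat (p 4)) (hat (p 5)) * det3 (hat (p 0)) (hat (p 1)) (hat (p 2)) ≤
    det3 (hat (p 3)) (hat (p 1)) (hat (p 2)) * det3 (hat (p 4)) (hat (p 5)) (hat (p 0))) at h'
  rw [not_le] at h h'
  rw [det3_rotate (hat (p 3)) (hat (p 1)), ← det3_rotate (hat (p 0)) (hat (p 4))] at h'
  have pos : ∀ i j k : Fin 7, i < j ∧ j < k → 0 < det3 (hat (p i)) (hat (p j)) (hat (p k)) :=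
    fun i j k h => hp i j k h.1 h.2
  have hpl := det3_plucker (hat (p 5)) (hat (p 6)) (hat (p 0)) (hat (p 3)) (hat (p 4))
  rw [← det3_rotate (hat (p 3)) (hat (p 5)), det3_rotate (hat (p 5)) (hat (p 0)),
    ← det3_rotate (hat (p 0)) (hat (p 5)), det3_rotate (hat (p 5)) (hat (p 3)),
    ← det3_rotate (hat (p 4)) (hat (p 5)), det3_rotate (hat (p 5)) (hat (p 0))] at hpl
  have h1 := mul_pos (pos 4 5 6 (by decide)) (pos 0 3 5 (by decide))
  have h012 := pos 0 1 2 (by decide)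
  have h123 := pos 1 2 3 (by decide)
  have h356 := pos 3 5 6 (by decide)
  have h045 := pos 0 4 5 (by decide)
  have hprod := mul_lt_mul'' h h' (by positivity) (by positivity)
  have := mul_pos h012 h123
  nlinarith [mul_pos this h1]

lemma Ccw.exists_rightGood {p : Fin 7 → Fin 2 → ℝ} (hp : Ccw p) :
    ∃ r, RightGood (relabel p r) := by
  by_contra! h
  have h6 := h 6
  have h0 := h 0
  have h1 := h 1
  change ¬ (det3 (hat (p 6)) (hat (p 4)) (hat (p 5)) * det3 (hat (p 0)) (hat (p 1)) (hat (p 2)) ≤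
    det3 (hat (p 6)) (hat (p 0)) (hat (p 1)) * det3 (hat (p 2)) (hat (p 4)) (hat (p 5))) at h6
  change ¬ (det3 (hat (p 0)) (hat (p 5)) (hat (p 6)) * det3 (hat (p 1)) (hat (p 2)) (hat (p 3)) ≤
    det3 (hat (p 0)) (hat (p 1)) (hat (p 2)) * det3 (hat (p 3)) (hat (p 5)) (hat (p 6))) at h0
  change ¬ (det3 (hat (p 1)) (hat (p 6)) (hat (p 0)) * det3 (hat (p 2)) (hat (p 3)) (hat (p 4)) ≤
    det3 (hat (p 1)) (hat (p 2)) (hat (p 3)) * det3 (hat (p 4)) (hat (p 6)) (hat (p 0))) at h1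
  rw [not_le] at h0 h1 h6
  rw [det3_rotate (hat (p 6)) (hat (p 4)), det3_rotate (hat (p 6)) (hat (p 0))] at h6
  rw [← det3_rotate (hat (p 0)) (hat (p 1)), ← det3_rotate (hat (p 0)) (hat (p 4))] at h1
  have pos : ∀ i j k : Fin 7, i < j ∧ j < k → 0 < det3 (hat (p i)) (hat (p j)) (hat (p k)) :=
    fun i j k h => hp i j k h.1 h.2
  have hpl := det3_plucker (hat (p 6)) (hat (p 0)) (hat (p 3)) (hat (p 4)) (hat (p 5))
  have hpl' := det3_plucker (hat (p 4)) (hat (p 5)) (hat (p 6)) (hat (p 2)) (hat (p 3))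
  rw [det3_rotate (hat (p 6)) (hat (p 0)), det3_rotate (hat (p 6)) (hat (p 3)),
    det3_rotate (hat (p 6)) (hat (p 0)) (hat (p 3)), det3_rotate (hat (p 6)) (hat (p 4)),
    det3_rotate (hat (p 6)) (hat (p 0)) (hat (p 5)), det3_rotate (hat (p 6)) (hat (p 3))] at hpl
  rw [← det3_rotate (hat (p 2)) (hat (p 4)), ← det3_rotate (hat (p 3)) (hat (p 4)),
    det3_rotate (hat (p 4)) (hat (p 2)), ← det3_rotate (hat (p 3)) (hat (p 4)),
    ← det3_rotate (hat (p 2)) (hat (p 4))] at hpl'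
  have x1 := mul_pos (pos 0 3 6 (by decide)) (pos 4 5 6 (by decide))
  have x2 := mul_pos (pos 3 4 5 (by decide)) (pos 2 4 6 (by decide))
  have h012 := pos 0 1 2 (by decide)
  have h123 := pos 1 2 3 (by decide)
  have h016 := pos 0 1 6 (by decide)
  have h356 := pos 3 5 6 (by decide)
  have h046 := pos 0 4 6 (by decide)
  have h245 := pos 2 4 5 (by decide)
  have h056 := pos 0 5 6 (by decide)
  have hprod := mul_lt_mul'' (mul_lt_mul'' h0 h1 (by positivity) (by positivity)) h6
    (by positivity) (by positivity)
  have hm := mul_pos (mul_pos h012 h123) h016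
  have y1 := mul_pos (mul_pos hm h245) x1
  have y2 := mul_pos (mul_pos hm h056) x2
  refine lt_irrefl (0 : ℝ) ?_
  linear_combination hprod + y1 + y2
    - det3 (hat (p 0)) (hat (p 1)) (hat (p 2)) * det3 (hat (p 1)) (hat (p 2)) (hat (p 3))
      * det3 (hat (p 0)) (hat (p 1)) (hat (p 6)) * (det3 (hat (p 2)) (hat (p 4)) (hat (p 5)) * hpl
      + det3 (hat (p 0)) (hat (p 5)) (hat (p 6)) * hpl')

lemma Ccw.exists_leftGood {p : Fin 7 → Fin 2 → ℝ} (hp : Ccw p) :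
    ∃ r, LeftGood (relabel p r) := by
  by_contra! h
  have h6 := h 6
  have h0 := h 0
  have h1 := h 1
  change ¬ (det3 (hat (p 6)) (hat (p 0)) (hat (p 1)) * det3 (hat (p 3)) (hat (p 4)) (hat (p 5)) ≤
    det3 (hat (p 6)) (hat (p 4)) (hat (p 5)) * det3 (hat (p 0)) (hat (p 1)) (hat (p 3))) at h6
  change ¬ (det3 (hat (p 0)) (hat (p 1)) (hat (p 2)) * det3 (hat (p 4)) (hat (p 5)) (hat (p 6)) ≤
    det3 (hat (p 0)) (hat (p 5)) (hat (p 6)) * det3 (hat (p 1)) (hat (p 2)) (hat (p 4))) at h0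
  change ¬ (det3 (hat (p 1)) (hat (p 2)) (hat (p 3)) * det3 (hat (p 5)) (hat (p 6)) (hat (p 0)) ≤
    det3 (hat (p 1)) (hat (p 6)) (hat (p 0)) * det3 (hat (p 2)) (hat (p 3)) (hat (p 5))) at h1
  rw [not_le] at h0 h1 h6
  rw [det3_rotate (hat (p 6)) (hat (p 4)), det3_rotate (hat (p 6)) (hat (p 0))] at h6
  rw [← det3_rotate (hat (p 0)) (hat (p 1)), ← det3_rotate (hat (p 0)) (hat (p 5))] at h1
  have pos : ∀ i j k : Fin 7, i < j ∧ j < k → 0 < det3 (hat (p i)) (hat (p j)) (hat (p k)) :=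
    fun i j k h => hp i j k h.1 h.2
  have hpl := det3_plucker (hat (p 1)) (hat (p 2)) (hat (p 3)) (hat (p 4)) (hat (p 0))
  have hpl' := det3_plucker (hat (p 3)) (hat (p 4)) (hat (p 5)) (hat (p 1)) (hat (p 2))
  rw [← det3_rotate (hat (p 0)) (hat (p 1)), ← det3_rotate (hat (p 0)) (hat (p 1)),
    ← det3_rotate (hat (p 0)) (hat (p 1))] at hpl
  rw [← det3_rotate (hat (p 1)) (hat (p 3)), ← det3_rotate (hat (p 2)) (hat (p 3)),
    det3_rotate (hat (p 3)) (hat (p 1)), ← det3_rotate (hat (p 2)) (hat (p 3)),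
    ← det3_rotate (hat (p 1)) (hat (p 3))] at hpl'
  have x1 := mul_pos (pos 1 2 3 (by decide)) (pos 0 1 4 (by decide))
  have x2 := mul_pos (pos 2 3 4 (by decide)) (pos 1 3 5 (by decide))
  have h456 := pos 4 5 6 (by decide)
  have h056 := pos 0 5 6 (by decide)
  have h016 := pos 0 1 6 (by decide)
  have h012 := pos 0 1 2 (by decide)
  have h235 := pos 2 3 5 (by decide)
  have h124 := pos 1 2 4 (by decide)
  have h013 := pos 0 1 3 (by decide)
  have hprod := mul_lt_mul'' (mul_lt_mul'' h0 h1 (by positivity) (by positivity)) h6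
    (by positivity) (by positivity)
  have hm := mul_pos (mul_pos h456 h056) h016
  have y1 := mul_pos (mul_pos hm h235) x1
  have y2 := mul_pos (mul_pos hm h012) x2
  refine lt_irrefl (0 : ℝ) ?_
  linear_combination hprod + y1 + y2
    - det3 (hat (p 4)) (hat (p 5)) (hat (p 6)) * det3 (hat (p 0)) (hat (p 5)) (hat (p 6))
      * det3 (hat (p 0)) (hat (p 1)) (hat (p 6)) * (det3 (hat (p 2)) (hat (p 3)) (hat (p 5)) * hpl
      + det3 (hat (p 0)) (hat (p 1)) (hat (p 2)) * hpl')

open Fin.CommRing in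
lemma Ccw.exists_good {p : Fin 7 → Fin 2 → ℝ} (hp : Ccw p) :
    ∃ r, LeftGood (relabel p r) ∧ RightGood (relabel p r) := by
  by_contra! h
  have step : ∀ r, ¬ RightGood (relabel p r) → ¬ RightGood (relabel p (r + 3)) := by
    intro r hr
    have := (hp.ccw_relabel r).leftGood_relabel_three hr
    rw [relabel_relabel] at this
    exact h _ this
  obtain ⟨s, hs⟩ := hp.exists_leftGood
  obtain ⟨t, ht⟩ := hp.exists_rightGood
  have hall : ∀ n : ℕ, ¬ RightGood (relabel p (s + (n : Fin 7) * 3)) := by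
    intro n
    induction n with
    | zero => simpa using h s hs
    | succ n ih =>
      have := step _ ih
      rwa [add_assoc, ← add_one_mul, ← Nat.cast_succ] at this
  refine hall ((5 * (t - s) : Fin 7) : ℕ) ?_
  have e : s + (((5 * (t - s) : Fin 7) : ℕ) : Fin 7) * 3 = t := by
    have : ∀ s t : Fin 7, s + (((5 * (t - s) : Fin 7) : ℕ) : Fin 7) * 3 = t := by decide
    exact this s t
  rwa [e]

/-- Every heptagon is a section of a polytope with at most 6 vertices in ℝ³. -/
theorem heptagon_section_of_six_vertex_polytope
    (p : Fin 7 → Fin 2 → ℝ)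
    (hconv : ∀ i j k : Fin 7, i < j → j < k →
      det3 (hat (p i)) (hat (p j)) (hat (p k)) < 0) :
    ∃ (V : Finset (Fin 3 → ℝ)) (f : (Fin 2 → ℝ) →ᵃ[ℝ] (Fin 3 → ℝ)),
      V.card ≤ 6 ∧ Function.Injective f ∧
      convexHull ℝ (V : Set (Fin 3 → ℝ)) ∩ Set.range f =
        f '' (convexHull ℝ (Set.range p)) := by
  have hp : Ccw (p ∘ Fin.rev) := by
    intro i j k hij hjk
    rw [det3_reverse, Left.neg_pos_iff]
    exact hconv _ _ _ (Fin.rev_lt_rev.2 hjk) (Fin.rev_lt_rev.2 hij)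
  obtain ⟨r, hl, hr⟩ := hp.exists_good
  have := exists_section_of_good (hp.ccw_relabel r) hl hr
  rwa [range_relabel, Fin.rev_surjective.range_comp] at this
end

section
/- No heptagon is a section of a polytope with at most 5 vertices in any dimension. Precisely: if p_0, …, p_6 ∈ ℝ² are in clockwise convex position and P = conv{p_0, …, p_6}, then for every D ≥ 2, every finite set V ⊆ ℝ^D with |V| ≤ 5, and every injective affine map f : ℝ² → ℝ^D, one has conv(V) ∩ range(f) ≠ f(P). Together with the existence of a section by a 3-polytope with 6 vertices, this shows every heptagon has intersection complexity exactly 6. -/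
open Matrix

/-! ### Bitmasks -/

/-- The bitmask of a set of at most five labels. -/
def mask (S : Finset (Fin 5)) : ℕ := Nat.ofBits fun k => decide (k ∈ S)

lemma mask_lt (S : Finset (Fin 5)) : mask S < 32 := Nat.ofBits_lt_two_pow _

lemma testBit_mask (S : Finset (Fin 5)) (k : Fin 5) : (mask S).testBit k = decide (k ∈ S) := by
  simp [mask]

/-- Whether the bits of `z` all occur in `x` or in `y`. -/
def maskCovered (x y z : ℕ) : Bool := Nat.beq (Nat.land z (Nat.lor x y)) z

lemma maskCovered_mask {S T U : Finset (Fin 5)} (h : maskCovered (mask T) (mask U) (mask S)) :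
    S ⊆ T ∪ U := by
  intro k hk
  have := congrArg (fun n => n.testBit k) (show mask S &&& (mask T ||| mask U) = mask S from
    Nat.eq_of_beq_eq_true h)
  simpa [testBit_mask, hk] using this

/-- Whether no two consecutive entries of the list jointly cover `x`. -/
def noConsecutiveCover (x : ℕ) : List ℕ → Bool
  | [] => true
  | [_] => true
  | y :: z :: s => !maskCovered y z x && noConsecutiveCover x (z :: s)

/-- Whether `x` can be put in front of a list without creating two consecutive entries that
jointly cover a further entry. -/
def canPrepend (x : ℕ) : List ℕ → Bool
  | [] => true
  | y :: s => noConsecutiveCover x (y :: s) && s.all fun z => !maskCovered x y z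

/-- Whether no two consecutive entries of the list jointly cover a further entry. -/
def isPath : List ℕ → Bool
  | [] => true
  | x :: s => canPrepend x s && isPath s

/-- All lists that satisfy `isPath` and whose entries are taken from the respective lists of
candidates. -/
def paths : List (List ℕ) → List (List ℕ)
  | [] => [[]]
  | C :: Cs => (paths Cs).flatMap fun s => (C.filter fun x => canPrepend x s).map (· :: s)

lemma mem_paths {Cs : List (List ℕ)} {s : List ℕ} (hC : List.Forall₂ (· ∈ ·) s Cs)
    (hs : isPath s) : s ∈ paths Cs := by
  induction hC with
  | nil => simp [paths]
  | cons hx _ ih =>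
    simp only [isPath, Bool.and_eq_true] at hs
    simpa [paths, hs.1, hx] using ih hs.2

/-- The bitmasks below 32 whose bit 4 is `b`. -/
def masksWithLastBit (b : Bool) : List ℕ := (List.range 32).filter fun m => m.testBit 4 == b

lemma mask_mem_masksWithLastBit (S : Finset (Fin 5)) :
    mask S ∈ masksWithLastBit (decide (4 ∈ S)) := by
  have := testBit_mask S 4
  simp_all [masksWithLastBit, mask_lt]

lemma paths_masksWithLastBit (b : Bool) :
    paths (masksWithLastBit false :: List.replicate 5 (masksWithLastBit b)) = [] := by
  revert b
  decide +kernel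

/-- The bitmasks of the two-element subsets of a five-element set. -/
def pairMasks : List ℕ := [3, 5, 6, 9, 10, 12, 17, 18, 20, 24]

lemma mask_mem_pairMasks : ∀ S : Finset (Fin 5), S.card = 2 → mask S ∈ pairMasks := by
  decide +kernel

lemma paths_pairMasks : paths (List.replicate 7 pairMasks) = [] := by
  decide +kernel

/-! ### Cyclic families of seven sets -/

/-- No two cyclically consecutive members of the family jointly cover a further member. -/
def NoConsecutiveCover (A : Fin 7 → Finset (Fin 5)) : Prop :=
  ∀ i j, i ≠ j → i ≠ j + 1 → ¬ A i ⊆ A j ∪ A (j + 1)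

lemma maskCovered_eq_false {A : Fin 7 → Finset (Fin 5)} (hA : NoConsecutiveCover A)
    (i j k : Fin 7) (hk : k + 1 = j) (h₁ : i ≠ k) (h₂ : i ≠ j) :
    maskCovered (mask (A j)) (mask (A k)) (mask (A i)) = false := by
  subst hk
  rw [Bool.eq_false_iff]
  intro h
  exact hA i k h₁ h₂ (Finset.union_comm (A (k + 1)) (A k) ▸ maskCovered_mask h)

lemma not_five_agree_last {A : Fin 7 → Finset (Fin 5)} (hA : NoConsecutiveCover A)
    (b : Bool) (h₀ : 4 ∉ A 0)
    (h : ∀ i, i ≠ 0 → i ≠ 1 → decide (4 ∈ A i) = b) : False := by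
  have hmem : ∀ i, i ≠ 0 → i ≠ 1 → mask (A i) ∈ masksWithLastBit b := fun i h₁ h₂ =>
    h i h₁ h₂ ▸ mask_mem_masksWithLastBit (A i)
  have hmem₀ : mask (A 0) ∈ masksWithLastBit false :=
    decide_eq_false h₀ ▸ mask_mem_masksWithLastBit (A 0)
  have hpath : [mask (A 0), mask (A 6), mask (A 5), mask (A 4), mask (A 3), mask (A 2)] ∈
      paths (masksWithLastBit false :: List.replicate 5 (masksWithLastBit b)) := by
    refine mem_paths ?_ ?_
    · simp [List.replicate, hmem, hmem₀]
    · simp [isPath, canPrepend, noConsecutiveCover, maskCovered_eq_false hA]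
  rw [paths_masksWithLastBit] at hpath
  exact List.not_mem_nil hpath

/-- The five members other than `A j` and `A (j + 1)` cannot agree on whether they contain `x` if
`A j` does not contain it. -/
lemma not_five_consecutive_agree {A : Fin 7 → Finset (Fin 5)} (hA : NoConsecutiveCover A)
    (j : Fin 7) (x : Fin 5) (b : Bool) (hj : x ∉ A j)
    (h : ∀ i, i ≠ j → i ≠ j + 1 → decide (x ∈ A i) = b) : False := by
  have hmem (i : Fin 7) : 4 ∈ (A i).map (Equiv.swap x 4).toEmbedding ↔ x ∈ A i := by
    simp [Finset.mem_map_equiv]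
  refine not_five_agree_last (A := fun i => (A (j + i)).map (Equiv.swap x 4).toEmbedding)
    (fun i k h₁ h₂ => ?_) b (by simpa only [hmem, add_zero] using hj)
    fun i h₁ h₂ => by simpa only [hmem] using h _ (by simpa using h₁) (by simpa using h₂)
  rw [← Finset.map_union, Finset.map_subset_map, ← add_assoc]
  exact hA _ _ (by simpa using h₁) (by simpa [add_assoc] using h₂)

lemma not_subset {A : Fin 7 → Finset (Fin 5)} (hA : NoConsecutiveCover A)
    (i j : Fin 7) (hij : i ≠ j) : ¬ A i ⊆ A j := by
  intro h
  by_cases h' : i = j + 1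
  · subst h'
    have h₁ : j + 1 ≠ j - 1 := by
      clear * - j
      revert j
      decide
    refine hA (j + 1) (j - 1) h₁ (by simp) ?_
    rw [sub_add_cancel]
    exact h.trans Finset.subset_union_right
  · exact hA i j hij h' (h.trans Finset.subset_union_left)

lemma card_union_le {A : Fin 7 → Finset (Fin 5)} (hA : NoConsecutiveCover A)
    (j : Fin 7) : (A j ∪ A (j + 1)).card ≤ 3 := by
  by_contra! hcard
  obtain ⟨x, hx⟩ : ∃ x, (A j ∪ A (j + 1))ᶜ ⊆ {x} := by
    rw [← Finset.card_le_one_iff_subset_singleton, Finset.card_compl, Fintype.card_fin]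
    omega
  have hmem (i : Fin 7) (h₁ : i ≠ j) (h₂ : i ≠ j + 1) : x ∈ A i ∧ x ∉ A j := by
    obtain ⟨y, hy, hy'⟩ := Finset.not_subset.mp (hA i j h₁ h₂)
    obtain rfl : y = x := Finset.mem_singleton.mp (hx (Finset.mem_compl.mpr hy'))
    exact ⟨hy, fun h => hy' (Finset.mem_union_left _ h)⟩
  exact not_five_consecutive_agree hA j x true (hmem (j + 2) (by simp) (by simp)).2
    fun i h₁ h₂ => decide_eq_true (hmem i h₁ h₂).1

lemma two_le_card {A : Fin 7 → Finset (Fin 5)} (hA : NoConsecutiveCover A)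
    (j : Fin 7) : 2 ≤ (A j).card := by
  by_contra! hcard
  obtain ⟨x, hx⟩ : ∃ x, A j ⊆ {x} := by
    rw [← Finset.card_le_one_iff_subset_singleton]
    omega
  have hnot (i : Fin 7) (h : i ≠ j) : x ∉ A i := fun hi =>
    not_subset hA j i h.symm (hx.trans (Finset.singleton_subset_iff.mpr hi))
  exact not_five_consecutive_agree hA (j - 1) x false (hnot _ (by simp))
    fun i _ h => decide_eq_false (hnot i (by simpa using h))

lemma card_eq_two {A : Fin 7 → Finset (Fin 5)} (hA : NoConsecutiveCover A)
    (j : Fin 7) : (A j).card = 2 := by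
  have hlt : (A j).card < (A j ∪ A (j + 1)).card :=
    Finset.card_lt_card ⟨Finset.subset_union_left, fun h => not_subset hA (j + 1) j
      (by simp) (Finset.subset_union_right.trans h)⟩
  have := card_union_le hA j
  have := two_le_card hA j
  omega

/-- Among seven cyclically ordered subsets of a five-element set, some two consecutive ones jointly
cover a third. -/
theorem not_noConsecutiveCover (A : Fin 7 → Finset (Fin 5)) : ¬ NoConsecutiveCover A := by
  intro hA
  have hpath : [mask (A 6), mask (A 5), mask (A 4), mask (A 3), mask (A 2), mask (A 1),
      mask (A 0)] ∈ paths (List.replicate 7 pairMasks) := by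
    refine mem_paths ?_ ?_
    · simp [List.replicate, mask_mem_pairMasks, card_eq_two hA]
    · simp [isPath, canPrepend, noConsecutiveCover, maskCovered_eq_false hA]
  rw [paths_pairMasks] at hpath
  exact List.not_mem_nil hpath

/-! ### Supports of the vertices of a section -/

lemma det3_hat (a b q : Fin 2 → ℝ) : det3 (hat a) (hat b) (hat q) =
    (b 0 - a 0) * (q 1 - a 1) - (b 1 - a 1) * (q 0 - a 0) := by
  simp [det3, hat, Matrix.det_fin_three]
  ring

lemma det3_hat_neg_of_cyclic {p : Fin 7 → Fin 2 → ℝ}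
    (hconv : ∀ i j k : Fin 7, i < j → j < k → det3 (hat (p i)) (hat (p j)) (hat (p k)) < 0)
    (i j : Fin 7) (h₁ : i ≠ j) (h₂ : i ≠ j + 1) :
    det3 (hat (p j)) (hat (p (j + 1))) (hat (p i)) < 0 := by
  have hcyc (a b c : Fin 2 → ℝ) :
      det3 (hat a) (hat b) (hat c) = det3 (hat b) (hat c) (hat a) := by
    rw [det3_hat, det3_hat]
    ring
  have : (j < j + 1 ∧ j + 1 < i) ∨ (i < j ∧ j < j + 1) ∨ (j + 1 < i ∧ i < j) := by
    revert i j
    decide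
  obtain h | h | h := this
  · exact hconv _ _ _ h.1 h.2
  · rw [← hcyc]
    exact hconv _ _ _ h.1 h.2
  · rw [hcyc]
    exact hconv _ _ _ h.1 h.2

lemma det3_hat_nonpos_of_mem_convexHull {p : Fin 7 → Fin 2 → ℝ} {a b q : Fin 2 → ℝ}
    (h : ∀ i, det3 (hat a) (hat b) (hat (p i)) ≤ 0) (hq : q ∈ convexHull ℝ (Set.range p)) :
    det3 (hat a) (hat b) (hat q) ≤ 0 := by
  have hsub : convexHull ℝ (Set.range p) ⊆ {q | det3 (hat a) (hat b) (hat q) ≤ 0} := by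
    refine convexHull_min (Set.range_subset_iff.mpr h) ?_
    intro x hx y hy s t hs ht hst
    simp only [Set.mem_ofPred_eq, det3_hat, Pi.add_apply, Pi.smul_apply, smul_eq_mul] at hx hy ⊢
    obtain rfl : t = 1 - s := by linarith
    nlinarith [mul_nonneg hs (neg_nonneg.mpr hx), mul_nonneg ht (neg_nonneg.mpr hy)]
  exact hsub hq

/-- A nonnegative function on a finite set dominates a small positive multiple of every function
supported in its support. -/
lemma exists_pos_mul_le {ι : Type*} (s : Finset ι) {a b : ι → ℝ} (hb : ∀ k ∈ s, 0 ≤ b k)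
    (hab : ∀ k ∈ s, b k = 0 → a k = 0) : ∃ ε : ℝ, 0 < ε ∧ ∀ k ∈ s, ε * a k ≤ b k := by
  have hev : ∀ᶠ ε : ℝ in nhdsWithin 0 (Set.Ioi 0), ∀ k ∈ s, ε * a k ≤ b k := by
    rw [Filter.eventually_all_finset]
    intro k hk
    rcases (hb k hk).eq_or_lt with h | h
    · simp [hab k hk h.symm, ← h]
    · have : Filter.Tendsto (fun ε : ℝ => ε * a k) (nhdsWithin 0 (Set.Ioi 0)) (nhds 0) := by
        have hc : Continuous fun ε : ℝ => ε * a k := by fun_prop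
        simpa using (hc.tendsto 0).mono_left nhdsWithin_le_nhds
      exact (this.eventually_lt_const h).mono fun _ => le_of_lt
  obtain ⟨ε, hε, hpos⟩ := (hev.and self_mem_nhdsWithin).exists
  exact ⟨ε, hpos, hε⟩

/-- If every point of `V` used to express `f u` is used to express `f a` or `f b`, then the section
contains a point beyond the midpoint of `a` and `b` as seen from `u`. -/
lemma exists_mem_section_beyond {F E : Type*} [AddCommGroup F] [Module ℝ F] [AddCommGroup E]
    [Module ℝ E] {V : Finset E} (f : F →ᵃ[ℝ] E) {a b u : F} {wa wb wu : E → ℝ}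
    (ha : ∀ y ∈ V, 0 ≤ wa y) (ha₁ : ∑ y ∈ V, wa y = 1) (ha' : ∑ y ∈ V, wa y • y = f a)
    (hb : ∀ y ∈ V, 0 ≤ wb y) (hb₁ : ∑ y ∈ V, wb y = 1) (hb' : ∑ y ∈ V, wb y • y = f b)
    (hu₁ : ∑ y ∈ V, wu y = 1) (hu' : ∑ y ∈ V, wu y • y = f u)
    (hsupp : ∀ y ∈ V, wa y = 0 → wb y = 0 → wu y = 0) :
    ∃ ε : ℝ, 0 < ε ∧ f (AffineMap.lineMap u (midpoint ℝ a b) (1 + ε)) ∈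
      convexHull ℝ (V : Set E) := by
  obtain ⟨ε, hε, hle⟩ := exists_pos_mul_le V (a := wu) (b := fun y => (wa y + wb y) / 2)
    (fun y hy => by linarith [ha y hy, hb y hy]) fun y hy h => by
      have h₁ := ha y hy
      have h₂ := hb y hy
      exact hsupp y hy (by linarith) (by linarith)
  refine ⟨ε, hε, Finset.mem_convexHull'.mpr
    ⟨fun y => (1 + ε) * ((wa y + wb y) / 2) - ε * wu y, fun y hy => ?_, ?_, ?_⟩⟩
  · have h₁ := hle y hy
    have h₂ := ha y hy
    have h₃ := hb y hy
    nlinarith [mul_nonneg hε.le (add_nonneg h₂ h₃)]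
  · rw [Finset.sum_sub_distrib, ← Finset.mul_sum, ← Finset.mul_sum, ← Finset.sum_div,
      Finset.sum_add_distrib, ha₁, hb₁, hu₁]
    ring
  · have hsum : ∑ y ∈ V, ((1 + ε) * ((wa y + wb y) / 2) - ε * wu y) • y =
        ((1 + ε) / 2) • (∑ y ∈ V, wa y • y + ∑ y ∈ V, wb y • y) - ε • ∑ y ∈ V, wu y • y := by
      rw [← Finset.sum_add_distrib, Finset.smul_sum, Finset.smul_sum, ← Finset.sum_sub_distrib]
      exact Finset.sum_congr rfl fun y _ => by module
    rw [hsum, ha', hb', hu', AffineMap.apply_lineMap, AffineMap.map_midpoint,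
      AffineMap.lineMap_apply_module, midpoint_eq_smul_add, invOf_eq_inv]
    module

/-- No heptagon is a section of a polytope with at most 5 vertices in any dimension. -/
theorem heptagon_not_section_of_five_vertex_polytope
    (p : Fin 7 → Fin 2 → ℝ)
    (hconv : ∀ i j k : Fin 7, i < j → j < k →
      det3 (hat (p i)) (hat (p j)) (hat (p k)) < 0) :
    ∀ (D : ℕ), 2 ≤ D →
      ∀ (V : Finset (Fin D → ℝ)) (f : (Fin 2 → ℝ) →ᵃ[ℝ] (Fin D → ℝ)),
        V.card ≤ 5 → Function.Injective f →
        convexHull ℝ (V : Set (Fin D → ℝ)) ∩ Set.range f ≠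
          f '' (convexHull ℝ (Set.range p)) := by
  intro D _ V f hV hf heq
  have hneg := det3_hat_neg_of_cyclic hconv
  have hmem (i : Fin 7) : f (p i) ∈ convexHull ℝ (V : Set (Fin D → ℝ)) :=
    (heq.superset (Set.mem_image_of_mem f (subset_convexHull ℝ _ (Set.mem_range_self i)))).1
  choose w hw hw₁ hw' using fun i => Finset.mem_convexHull'.mp (hmem i)
  obtain ⟨e⟩ : Nonempty (V ↪ Fin 5) :=
    Function.Embedding.nonempty_of_card_le (by simpa using hV)
  refine not_noConsecutiveCover
    (fun i => (Finset.univ.filter fun y : V => w i y ≠ 0).map e) fun i j h₁ h₂ hsub => ?_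
  rw [← Finset.map_union, Finset.map_subset_map] at hsub
  obtain ⟨ε, hε, hq⟩ := exists_mem_section_beyond f (hw j) (hw₁ j) (hw' j) (hw (j + 1))
    (hw₁ (j + 1)) (hw' (j + 1)) (hw₁ i) (hw' i) fun y hy h h' => by
      by_contra hne
      have := @hsub ⟨y, hy⟩ (by simpa using hne)
      simp [h, h'] at this
  obtain ⟨q, hqP, hfq⟩ := heq.subset ⟨hq, Set.mem_range_self _⟩
  rw [hf hfq] at hqP
  have hle := det3_hat_nonpos_of_mem_convexHull (a := p j) (b := p (j + 1)) (fun k => ?_) hqP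
  · have hi := hneg i j h₁ h₂
    rw [det3_hat] at hle hi
    simp only [AffineMap.lineMap_apply_module, midpoint_eq_smul_add, invOf_eq_inv, Pi.add_apply,
      Pi.smul_apply, smul_eq_mul] at hle
    nlinarith [mul_pos hε (neg_pos.mpr hi)]
  · by_cases hk : k = j
    · simp [hk, det3_hat]
    by_cases hk' : k = j + 1
    · rw [hk', det3_hat]
      exact (by ring : _ = (0 : ℝ)).le
    exact (hneg k j hk hk').le
end

section
/- Every standard heptagon P is a section of a 3-polytope with 6 vertices: there exists a set V ⊆ ℝ³ of at most 6 points such that conv(V) ∩ (ℝ² × {0}) = P × {0}. -/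
open Matrix

/-- If a convex set contains the triangle `0, e, f` and a segment parallel to `f`, suitably placed
on the other side of the line through `0` and `f`, then it contains the whole translated and
rescaled copy of the triangle that is spanned by that segment. -/
lemma Convex.homothetic_triangle_vertex_mem {E : Type*} [AddCommGroup E] [Module ℝ E]
    {C : Set E} (hC : Convex ℝ C) {e f : E} (he : e ∈ C) (hf : f ∈ C) {a b c : ℝ}
    (ha : 0 < a) (hb : 0 < b) (hbc : b < c) (hca : c < 1 + a)
    (hu : -a • e + b • f ∈ C) (hv : -a • e + c • f ∈ C) :
    (c - b - a) • e + b • f ∈ C := by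
  have comb : ∀ {x y z : E} {r s t : ℝ}, x ∈ C → y ∈ C → z ∈ C → 0 ≤ r → 0 ≤ s → 0 ≤ t →
      r + s + t = 1 → r • x + s • y + t • z ∈ C := by
    intro x y z r s t hx hy hz hr hs ht h
    have := hC.sum_mem (t := Finset.univ) (w := ![r, s, t]) (z := ![x, y, z])
      (by intro i _; fin_cases i <;> simpa) (by simpa [Fin.sum_univ_three] using h)
      (by intro i _; fin_cases i <;> simpa)
    simpa [Fin.sum_univ_three] using this
  rcases le_total b 1 with h1 | h1
  · have hd : 0 < a + 1 - b := by linarith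
    have hs : 0 ≤ (c - b) / (a + 1 - b) := div_nonneg (by linarith) hd.le
    have hs1 : (c - b) / (a + 1 - b) ≤ 1 := by rw [div_le_one hd]; linarith
    convert comb hu he hf (sub_nonneg.2 hs1) (mul_nonneg hs (sub_nonneg.2 h1))
      (mul_nonneg hs hb.le) (by ring) using 1
    match_scalars <;> field_simp <;> ring
  · have hs1 : (c - 1) / a ≤ 1 := by rw [div_le_one ha]; linarith
    convert comb hu hf hv (sub_nonneg.2 hs1) (div_nonneg (sub_nonneg.2 hbc.le) ha.le)
      (div_nonneg (sub_nonneg.2 h1) ha.le) (by field_simp; ring) using 1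
    match_scalars <;> field_simp <;> ring

/-- The apex over the point `c` such that joining it to the triangle with legs `K` at height `-1`
cuts the plane at height `0` in the right triangle with corner `c` and legs `r`. -/
noncomputable def apex (K : ℝ) (c : Fin 2 → ℝ) (r : ℝ) : Fin 3 → ℝ :=
  ![K * c 0 / (K - r), K * c 1 / (K - r), r / (K - r)]

/-- The vertices of the right triangle with legs `K` at height `-1`. -/
def base (K : ℝ) : Fin 3 → Fin 3 → ℝ := ![![0, 0, -1], ![K, 0, -1], ![0, K, -1]]

/-- The vertices of the right triangle with corner `c` and legs `r`. -/
def rightTriangle (c : Fin 2 → ℝ) (r : ℝ) : Fin 3 → Fin 2 → ℝ :=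
  ![![c 0, c 1], ![c 0 + r, c 1], ![c 0, c 1 + r]]

lemma rightTriangle_eq_combination {K r : ℝ} (hr : 0 < r) (hK : r < K) (c : Fin 2 → ℝ)
    (j : Fin 3) :
    ![rightTriangle c r j 0, rightTriangle c r j 1, 0] =
      (1 - r / K) • apex K c r + (r / K) • base K j := by
  have h1 : 0 < K := hr.trans hK
  have h2 : K - r ≠ 0 := (sub_pos.2 hK).ne'
  ext i
  fin_cases j <;> fin_cases i <;> simp [rightTriangle, apex, base] <;> field_simp <;> ring

/-- A convex hull of finitely many points consists of their convex combinations. -/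
lemma exists_weights_of_mem_convexHull_range {ι E : Type*} [Fintype ι] [AddCommGroup E]
    [Module ℝ E] {f : ι → E} {x : E} (hx : x ∈ convexHull ℝ (Set.range f)) :
    ∃ w : ι → ℝ, (∀ i, 0 ≤ w i) ∧ ∑ i, w i = 1 ∧ ∑ i, w i • f i = x := by
  classical
  rw [convexHull_range_eq_exists_affineCombination] at hx
  obtain ⟨s, w, hw, hw1, rfl⟩ := hx
  refine ⟨fun i => if i ∈ s then w i else 0, fun i => ?_, ?_, ?_⟩
  · dsimp only
    split_ifs with h
    exacts [hw i h, le_rfl]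
  · simpa using hw1
  · simp [s.affineCombination_eq_linear_combination f w hw1, ite_smul]

/-- The horizontal section of the convex hull of apices and a triangle is the convex hull of
homothetic triangles. -/
lemma convexHull_apex_base_section {ι : Type*} [Finite ι] {K : ℝ} (c : ι → Fin 2 → ℝ)
    (r : ι → ℝ) (hr : ∀ i, 0 < r i) (hK : ∀ i, r i < K) :
    convexHull ℝ (Set.range (Sum.elim (fun i => apex K (c i) (r i)) (base K))) ∩
        {x : Fin 3 → ℝ | x 2 = 0} =
      (fun q : Fin 2 → ℝ => ![q 0, q 1, 0]) '' convexHull ℝ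
        (Set.range fun ij : ι × Fin 3 => rightTriangle (c ij.1) (r ij.1) ij.2) := by
  have := Fintype.ofFinite ι
  apply Set.Subset.antisymm
  · rintro x ⟨hx, hx2 : x 2 = 0⟩
    obtain ⟨w, hw, hw1, rfl⟩ := exists_weights_of_mem_convexHull_range hx
    obtain ⟨α, β, rfl⟩ : ∃ α β, w = Sum.elim α β := ⟨_, _, (Sum.elim_comp_inl_inr w).symm⟩
    simp only [Fintype.sum_sum_type, Sum.elim_inl, Sum.elim_inr, Fin.sum_univ_three (f := β)]
      at hw1 hx2 ⊢
    have hKr : ∀ i, 0 < K - r i := fun i => sub_pos.2 (hK i)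
    have hS : ∑ i, α i * (r i / (K - r i)) = β 0 + β 1 + β 2 := by
      simp [apex, base, Fin.sum_univ_three, Finset.sum_apply] at hx2
      linarith
    have hα0 : ∀ i, 0 ≤ α i := fun i => hw (Sum.inl i)
    have hβ0 : ∀ j, 0 ≤ β j := fun j => hw (Sum.inr j)
    have hterm : ∀ i, 0 ≤ α i * (r i / (K - r i)) := fun i =>
      mul_nonneg (hα0 i) (div_pos (hr i) (hKr i)).le
    set S := β 0 + β 1 + β 2 with hSdef
    have hSpos : 0 < S := by
      have hS0 : 0 ≤ S := by rw [← hS]; exact Finset.sum_nonneg fun i _ => hterm i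
      refine hS0.lt_of_ne' fun h => ?_
      rw [h, Finset.sum_eq_zero_iff_of_nonneg fun i _ => hterm i] at hS
      have hz : ∀ i, α i = 0 := fun i =>
        (mul_eq_zero.1 (hS i (Finset.mem_univ i))).resolve_right (div_pos (hr i) (hKr i)).ne'
      simp [h, hz] at hw1
    have hsplit : ∀ i, α i * (K / (K - r i)) = α i + α i * (r i / (K - r i)) := fun i => by
      have := (hKr i).ne'
      field_simp
      ring
    refine ⟨∑ ij : ι × Fin 3, (α ij.1 * (K / (K - r ij.1)) * (β ij.2 / S)) •
      rightTriangle (c ij.1) (r ij.1) ij.2, ?_, ?_⟩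
    · refine (convex_convexHull ℝ _).sum_mem (fun ij _ => ?_) ?_
        fun ij _ => subset_convexHull ℝ _ ⟨ij, rfl⟩
      · rw [hsplit]
        exact mul_nonneg (add_nonneg (hα0 _) (hterm _)) (div_nonneg (hβ0 _) hSpos.le)
      · rw [Fintype.sum_prod_type]
        simp only [← Finset.mul_sum, ← Finset.sum_mul, ← Finset.sum_div, hsplit,
          Finset.sum_add_distrib, Fin.sum_univ_three]
        rw [hS, ← hSdef, div_self hSpos.ne', mul_one, hw1]
    · have key : ∀ (x : ι → ℝ) (b : ℝ),
          ∑ i, α i * (K / (K - r i)) * (x i + b / S * r i) =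
            ∑ i, α i * (K * x i / (K - r i)) + b * K := by
        intro x b
        have : b * K = ∑ i, (b / S * K) * (α i * (r i / (K - r i))) := by
          rw [← Finset.mul_sum, hS]
          field_simp
        rw [this, ← Finset.sum_add_distrib]
        refine Finset.sum_congr rfl fun i _ => ?_
        ring
      have hone : β 0 / S + β 1 / S + β 2 / S = 1 := by
        rw [← add_div, ← add_div, div_self hSpos.ne']
      ext k
      fin_cases k
      · have hkey := key (fun i => c i 0) (β 1)
        simp [apex, base, rightTriangle, Fintype.sum_prod_type, Fin.sum_univ_three,
          Finset.sum_apply]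
        rw [← hkey]
        refine Finset.sum_congr rfl fun i _ => ?_
        linear_combination α i * (K / (K - r i)) * c i 0 * hone
      · have hkey := key (fun i => c i 1) (β 2)
        simp [apex, base, rightTriangle, Fintype.sum_prod_type, Fin.sum_univ_three,
          Finset.sum_apply]
        rw [← hkey]
        refine Finset.sum_congr rfl fun i _ => ?_
        linear_combination α i * (K / (K - r i)) * c i 1 * hone
      · simpa using hx2.symm
  · rintro _ ⟨q, hq, rfl⟩
    refine ⟨?_, by simp⟩
    let L : (Fin 2 → ℝ) →ₗ[ℝ] (Fin 3 → ℝ) :=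
      { toFun := fun q => ![q 0, q 1, 0]
        map_add' := fun x y => by ext i; fin_cases i <;> simp
        map_smul' := fun t x => by ext i; fin_cases i <;> simp }
    have hsub : convexHull ℝ
        (Set.range fun ij : ι × Fin 3 => rightTriangle (c ij.1) (r ij.1) ij.2) ⊆
        L ⁻¹' convexHull ℝ (Set.range (Sum.elim (fun i => apex K (c i) (r i)) (base K))) := by
      refine convexHull_min ?_ ((convex_convexHull ℝ _).linear_preimage L)
      rintro _ ⟨⟨i, j⟩, rfl⟩
      change ![rightTriangle (c i) (r i) j 0, rightTriangle (c i) (r i) j 1, 0] ∈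
        convexHull ℝ (Set.range (Sum.elim (fun i => apex K (c i) (r i)) (base K)))
      rw [rightTriangle_eq_combination (hr i) (hK i)]
      have hK0 : 0 < K := (hr i).trans (hK i)
      exact convex_convexHull ℝ _
        (subset_convexHull ℝ _ (Set.mem_range_self (f := Sum.elim _ _) (Sum.inl i)))
        (subset_convexHull ℝ _ (Set.mem_range_self (f := Sum.elim _ _) (Sum.inr j)))
        (sub_nonneg.2 ((div_le_one hK0).2 (hK i).le)) (div_nonneg (hr i).le hK0.le) (by ring)
    exact hsub hq

/-- Every standard heptagon (vertices `p 0, …, p 6` clockwise, with `p 0 = (0,0)`,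
`p 3 = (0,1)`, `p₋₃ = p 4 = (1,0)`, `p 1, p 2` with equal first coordinate, and
`p₋₁ = p 6, p₋₂ = p 5` with equal second coordinate) is the section of a 3-polytope
with at most 6 vertices by the horizontal plane `z = 0`. -/
theorem standard_heptagon_section
    (p : Fin 7 → Fin 2 → ℝ)
    (hconv : ∀ i j k : Fin 7, i < j → j < k →
      det3 (hat (p i)) (hat (p j)) (hat (p k)) < 0)
    (h0 : p 0 = ![0, 0]) (h3 : p 3 = ![0, 1]) (h4 : p 4 = ![1, 0])
    (h12 : p 1 0 = p 2 0) (h56 : p 6 1 = p 5 1) :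
    ∃ V : Finset (Fin 3 → ℝ), V.card ≤ 6 ∧
      convexHull ℝ (V : Set (Fin 3 → ℝ)) ∩ {x : Fin 3 → ℝ | x 2 = 0} =
        (fun q : Fin 2 → ℝ => ![q 0, q 1, 0]) '' (convexHull ℝ (Set.range p)) := by
  have d : ∀ i j k : Fin 7, i < j → j < k →
      p i 0 * (p j 1 - p k 1) - p i 1 * (p j 0 - p k 0) + (p j 0 * p k 1 - p j 1 * p k 0) < 0 := by
    intro i j k hij hjk
    have := hconv i j k hij hjk
    simp [det3, hat, Matrix.det_fin_three] at this
    linarith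
  have h013 := d 0 1 3 (by decide) (by decide)
  have h012 := d 0 1 2 (by decide) (by decide)
  have h014 := d 0 1 4 (by decide) (by decide)
  have h234 := d 2 3 4 (by decide) (by decide)
  have h046 := d 0 4 6 (by decide) (by decide)
  have h056 := d 0 5 6 (by decide) (by decide)
  have h036 := d 0 3 6 (by decide) (by decide)
  have h345 := d 3 4 5 (by decide) (by decide)
  simp [h0, h3, h4, h12] at h013 h012 h014 h234
  simp [h0, h3, h4, h56] at h046 h056 h036 h345
  have ht : p 1 1 < p 2 1 := by nlinarith
  have hs : p 6 0 < p 5 0 := by nlinarith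
  let c : Fin 3 → Fin 2 → ℝ := ![p 0, p 1, p 6]
  let r : Fin 3 → ℝ := ![1, p 2 1 - p 1 1, p 5 0 - p 6 0]
  let K : ℝ := 2 + (p 2 1 - p 1 1) + (p 5 0 - p 6 0)
  have hr : ∀ i, 0 < r i := by
    intro i; fin_cases i <;> simp [r] <;> linarith
  have hK : ∀ i, r i < K := by
    intro i; fin_cases i <;> simp [r, K] <;> linarith
  classical
  refine ⟨Finset.univ.image (Sum.elim (fun i => apex K (c i) (r i)) (base K)),
    Finset.card_image_le.trans (by simp), ?_⟩
  rw [Finset.coe_image, Finset.coe_univ, Set.image_univ, convexHull_apex_base_section c r hr hK]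
  congr 1
  have hp : ∀ i, p i ∈ convexHull ℝ (Set.range p) := fun i => subset_convexHull ℝ _ ⟨i, rfl⟩
  have hC : Convex ℝ (convexHull ℝ (Set.range p)) := convex_convexHull ℝ _
  apply Set.Subset.antisymm
  · refine convexHull_min ?_ hC
    have he : ![1, 0] ∈ convexHull ℝ (Set.range p) := h4 ▸ hp 4
    have hf : ![0, 1] ∈ convexHull ℝ (Set.range p) := h3 ▸ hp 3
    have hv1 := hC.homothetic_triangle_vertex_mem he hf (a := -p 1 0) (b := p 1 1) (c := p 2 1)
      (by linarith) (by linarith) ht (by linarith)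
      (by convert hp 1 using 1; ext k; fin_cases k <;> simp)
      (by convert hp 2 using 1; ext k; fin_cases k <;> simp [h12])
    have hv6 := hC.homothetic_triangle_vertex_mem hf he (a := -p 6 1) (b := p 6 0) (c := p 5 0)
      (by linarith) (by linarith) hs (by linarith)
      (by convert hp 6 using 1; ext k; fin_cases k <;> simp)
      (by convert hp 5 using 1; ext k; fin_cases k <;> simp [h56])
    rintro _ ⟨⟨i, j⟩, rfl⟩
    fin_cases i <;> fin_cases j
    · convert hp 0 using 1; ext k; fin_cases k <;> simp [rightTriangle, c]
    · convert hp 4 using 1; ext k; fin_cases k <;> simp [rightTriangle, c, r, h0, h4]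
    · convert hp 3 using 1; ext k; fin_cases k <;> simp [rightTriangle, c, r, h0, h3]
    · convert hp 1 using 1; ext k; fin_cases k <;> simp [rightTriangle, c]
    · convert hv1 using 1; ext k; fin_cases k <;> simp [rightTriangle, c, r]; ring
    · convert hp 2 using 1; ext k; fin_cases k <;> simp [rightTriangle, c, r, h12]
    · convert hp 6 using 1; ext k; fin_cases k <;> simp [rightTriangle, c]
    · convert hp 5 using 1; ext k; fin_cases k <;> simp [rightTriangle, c, r, h56]
    · convert hv6 using 1; ext k; fin_cases k <;> simp [rightTriangle, c, r]; ring
  · refine convexHull_mono ?_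
    rintro _ ⟨i, rfl⟩
    have hmem : ∀ i j, rightTriangle (c i) (r i) j ∈
        Set.range fun ij : Fin 3 × Fin 3 => rightTriangle (c ij.1) (r ij.1) ij.2 :=
      fun i j => ⟨(i, j), rfl⟩
    fin_cases i
    · convert hmem 0 0 using 1; ext k; fin_cases k <;> simp [rightTriangle, c]
    · convert hmem 1 0 using 1; ext k; fin_cases k <;> simp [rightTriangle, c]
    · convert hmem 1 2 using 1; ext k; fin_cases k <;> simp [rightTriangle, c, r, h12]
    · convert hmem 0 2 using 1; ext k; fin_cases k <;> simp [rightTriangle, c, r, h0, h3]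
    · convert hmem 0 1 using 1; ext k; fin_cases k <;> simp [rightTriangle, c, r, h0, h4]
    · convert hmem 2 1 using 1; ext k; fin_cases k <;> simp [rightTriangle, c, r, h56]
    · convert hmem 2 0 using 1; ext k; fin_cases k <;> simp [rightTriangle, c]
end
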